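/- arXiv:2010.07918 — 2 statements merged into one kernel-verified Lean document; each statement's English description precedes it below -/
import Mathlib

section
/- In the 𝔪-primary case, the homogeneous polynomial G(n_1,…,n_r) of total degree d equal to lim_{m→∞} dim_𝕜( R / J(1)_{m n_1}⋯J(r)_{m n_r} ) / m^d has all of its coefficients non-negative; equivalently, writing G(𝐧) = Σ_{|𝐝|=d} (a_𝐝/𝐝!)·𝐧^𝐝, one has a_𝐝 ≥ 0 for every 𝐝 ∈ ℕ^r with |𝐝| = d. -/
open Filter MvPolynomial Pointwise MeasureTheory

noncomputable section

/-- The graded irrelevant (maximal graded) ideal `𝔪 = (x_1, …, x_d)` of `𝕜[x_1, …, x_d]`. -/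
def mId (𝕜 : Type*) [Field 𝕜] (d : ℕ) : Ideal (MvPolynomial (Fin d) 𝕜) :=
  Ideal.span (Set.range MvPolynomial.X)

/-- A graded family of ideals: `I 0 = R` and `I i * I j ⊆ I (i + j)`. -/
def IsGradedFamily {R : Type*} [CommSemiring R] (I : ℕ → Ideal R) : Prop :=
  I 0 = ⊤ ∧ ∀ i j : ℕ, I i * I j ≤ I (i + j)

/-- An `𝔪`-primary ideal of the polynomial ring: a proper ideal containing a power of `𝔪`. -/
def IsMPrimary {𝕜 : Type*} [Field 𝕜] {d : ℕ} (I : Ideal (MvPolynomial (Fin d) 𝕜)) : Prop :=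
  I ≠ ⊤ ∧ ∃ k : ℕ, mId 𝕜 d ^ k ≤ I

/-- A monomial ideal: an ideal generated by monomials. -/
def IsMonomialIdeal {𝕜 : Type*} [Field 𝕜] {d : ℕ} (I : Ideal (MvPolynomial (Fin d) 𝕜)) : Prop :=
  ∃ S : Set (Fin d →₀ ℕ), I = Ideal.span ((fun m => MvPolynomial.monomial m (1 : 𝕜)) '' S)

/-- A nonzero monomial ideal generated by monomials of degree at most `b`;
for nonzero monomial ideals this is exactly the condition `β(I) ≤ b`. -/
def IsMonomialBounded {𝕜 : Type*} [Field 𝕜] {d : ℕ} (I : Ideal (MvPolynomial (Fin d) 𝕜))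
    (b : ℕ) : Prop :=
  I ≠ ⊥ ∧ ∃ S : Set (Fin d →₀ ℕ), (∀ m ∈ S, (∑ j, m j) ≤ b) ∧
    I = Ideal.span ((fun m => MvPolynomial.monomial m (1 : 𝕜)) '' S)

/-- The `𝕜`-vector space dimension of the quotient `A / (A ⊓ B)`; for `B ⊆ A`
this is `dim_𝕜 (A / B)`. -/
def quotDim (𝕜 : Type*) [Field 𝕜] {R : Type*} [CommRing R] [Algebra 𝕜 R]
    (A B : Ideal R) : ℕ :=
  Module.finrank 𝕜
    (↥(Submodule.restrictScalars 𝕜 A) ⧸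
      Submodule.comap (Submodule.restrictScalars 𝕜 A).subtype (Submodule.restrictScalars 𝕜 B))

/-- Iterated forward difference of `f` with step `s` along the coordinate directions in a list. -/
def mixedDiff {r : ℕ} (s : ℕ) : List (Fin r) → ((Fin r → ℕ) → ℝ) → (Fin r → ℕ) → ℝ
  | [], f => f
  | l :: ls, f => mixedDiff s ls (fwdDiff (Pi.single l s) f)

section MixedDiff

variable {r : ℕ}

lemma mixedDiff_add (s : ℕ) (ls : List (Fin r)) (f g : (Fin r → ℕ) → ℝ) :
    mixedDiff s ls (f + g) = mixedDiff s ls f + mixedDiff s ls g := by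
  induction ls generalizing f g with
  | nil => rfl
  | cons l ls ih => simp only [mixedDiff, fwdDiff_add, ih]

lemma mixedDiff_const_smul (s : ℕ) (ls : List (Fin r)) (a : ℝ) (f : (Fin r → ℕ) → ℝ) :
    mixedDiff s ls (a • f) = a • mixedDiff s ls f := by
  induction ls generalizing f with
  | nil => rfl
  | cons l ls ih => simp only [mixedDiff, fwdDiff_const_smul, ih]

lemma mixedDiff_zero (s : ℕ) (ls : List (Fin r)) : mixedDiff s ls 0 = 0 := by
  simpa using mixedDiff_const_smul s ls 0 0

lemma mixedDiff_finset_sum {ι : Type*} (s : ℕ) (ls : List (Fin r)) (T : Finset ι)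
    (f : ι → (Fin r → ℕ) → ℝ) :
    mixedDiff s ls (∑ i ∈ T, f i) = ∑ i ∈ T, mixedDiff s ls (f i) := by
  classical
  induction T using Finset.induction_on with
  | empty => simpa using mixedDiff_zero s ls
  | insert a T ha ih => rw [Finset.sum_insert ha, Finset.sum_insert ha, mixedDiff_add, ih]

lemma mixedDiff_comp_add (s : ℕ) (ls : List (Fin r)) (f : (Fin r → ℕ) → ℝ) (m n : Fin r → ℕ) :
    mixedDiff s ls (fun x => f (x + m)) n = mixedDiff s ls f (n + m) := by
  induction ls generalizing f with
  | nil => rfl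
  | cons l ls ih =>
    have : fwdDiff (Pi.single l s) (fun x => f (x + m)) =
        fun x => fwdDiff (Pi.single l s) f (x + m) := by
      funext x
      exact fwdDiff_comp_add _ f m x
    simp only [mixedDiff, this, ih]

lemma mixedDiff_comp_smul (t : ℕ) (ls : List (Fin r)) (f : (Fin r → ℕ) → ℝ) (n : Fin r → ℕ) :
    mixedDiff 1 ls (fun x => f (t • x)) n = mixedDiff t ls f (t • n) := by
  induction ls generalizing f with
  | nil => rfl
  | cons l ls ih =>
    have : fwdDiff (Pi.single l 1) (fun x => f (t • x)) =
        fun x => fwdDiff (Pi.single l t) f (t • x) := by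
      funext x
      simp only [fwdDiff, smul_add]
      rw [← Pi.single_smul]
      simp
    simp only [mixedDiff, this, ih]

lemma tendsto_mixedDiff {ι : Type*} {F : Filter ι} (s : ℕ) (ls : List (Fin r))
    {f : ι → (Fin r → ℕ) → ℝ} {g : (Fin r → ℕ) → ℝ}
    (h : ∀ n, Tendsto (fun i => f i n) F (nhds (g n))) (n : Fin r → ℕ) :
    Tendsto (fun i => mixedDiff s ls (f i) n) F (nhds (mixedDiff s ls g n)) := by
  induction ls generalizing f g with
  | nil => exact h n
  | cons l ls ih => exact ih fun n => (h _).sub (h _)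

lemma fwdDiff_single_eq_sum (l : Fin r) (t : ℕ) (f : (Fin r → ℕ) → ℝ) :
    fwdDiff (Pi.single l t) f =
      ∑ j ∈ Finset.range t, fun x => fwdDiff (Pi.single l 1) f (x + Pi.single l j) := by
  funext x
  have := Finset.sum_range_sub (fun j => f (x + Pi.single l j)) t
  simp only [Pi.single_zero, add_zero] at this
  simp only [Finset.sum_apply, fwdDiff, add_assoc, ← Pi.single_add, this]

lemma mixedDiff_nonneg_of_one {t : ℕ} (ls : List (Fin r)) {f : (Fin r → ℕ) → ℝ} {a : Fin r → ℕ}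
    (h : ∀ n, a ≤ n → 0 ≤ mixedDiff 1 ls f n) {n : Fin r → ℕ} (hn : a ≤ n) :
    0 ≤ mixedDiff t ls f n := by
  induction ls generalizing f with
  | nil => exact h n hn
  | cons l ls ih =>
    refine ih (f := fwdDiff (Pi.single l t) f) fun n hn => ?_
    rw [fwdDiff_single_eq_sum, mixedDiff_finset_sum, Finset.sum_apply]
    refine Finset.sum_nonneg fun j _ => ?_
    rw [mixedDiff_comp_add]
    exact h _ (hn.trans le_self_add)

lemma mixedDiff_prod (ls : List (Fin r)) (u : Fin r → ℕ → ℝ) :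
    mixedDiff 1 ls (fun n => ∏ l, u l (n l)) =
      fun n => ∏ l, (fwdDiff 1)^[ls.count l] (u l) (n l) := by
  induction ls generalizing u with
  | nil => rfl
  | cons i ls ih =>
    have : fwdDiff (Pi.single i 1) (fun n : Fin r → ℕ => ∏ l, u l (n l)) =
        fun n => ∏ l, Function.update u i (fwdDiff 1 (u i)) l (n l) := by
      funext n
      simp only [fwdDiff, ← Finset.mul_prod_erase Finset.univ _ (Finset.mem_univ i)]
      have h1 : ∏ l ∈ Finset.univ.erase i, u l ((n + Pi.single i 1 : Fin r → ℕ) l) =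
          ∏ l ∈ Finset.univ.erase i, u l (n l) :=
        Finset.prod_congr rfl fun l hl => by simp [Finset.ne_of_mem_erase hl]
      have h2 : ∏ l ∈ Finset.univ.erase i,
            Function.update u i (fwdDiff 1 (u i)) l (n l) =
          ∏ l ∈ Finset.univ.erase i, u l (n l) :=
        Finset.prod_congr rfl fun l hl => by simp [Finset.ne_of_mem_erase hl]
      rw [h1, h2]
      simp [fwdDiff, sub_mul]
    rw [mixedDiff, this, ih]
    funext n
    refine Finset.prod_congr rfl fun l _ => ?_
    by_cases h : l = i
    · subst h
      simp [Function.iterate_succ_apply]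
    · simp [h, Ne.symm h]

lemma fwdDiff_iter_comp_natCast (k : ℕ) (f : ℝ → ℝ) (x : ℕ) :
    (fwdDiff 1)^[k] (fun y : ℕ => f y) x = (fwdDiff 1)^[k] f x := by
  induction k generalizing f with
  | zero => rfl
  | succ k ih =>
    simp only [Function.iterate_succ_apply, ← ih]
    have : fwdDiff 1 (fun y : ℕ => f y) = fun y : ℕ => fwdDiff 1 f (y : ℝ) := by
      funext y
      simp [fwdDiff]
    rw [this]

lemma mixedDiff_eval_of_isHomogeneous {d : ℕ} {G : MvPolynomial (Fin r) ℝ}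
    (hG : G.IsHomogeneous d) {e : Fin r →₀ ℕ} (he : e.degree = d) (n : Fin r → ℕ) :
    mixedDiff 1 (Finsupp.toMultiset e).toList
        (fun n => MvPolynomial.eval (fun i => (n i : ℝ)) G) n =
      G.coeff e * ∏ l, ((e l).factorial : ℝ) := by
  classical
  have hfun : (fun n : Fin r → ℕ => MvPolynomial.eval (fun i => (n i : ℝ)) G) =
      ∑ b ∈ G.support, G.coeff b • fun n : Fin r → ℕ => ∏ l, (fun x : ℕ => (x : ℝ) ^ b l) (n l) := by
    funext n
    simp [MvPolynomial.eval_eq', Finset.sum_apply]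
  have hcount : ∀ l, (Finsupp.toMultiset e).toList.count l = e l := fun l => by
    rw [← Multiset.coe_count, Multiset.coe_toList, Finsupp.count_toMultiset]
  have hterm : ∀ b ∈ G.support, b ≠ e →
      ∏ l, (fwdDiff 1)^[e l] (fun x : ℕ => (x : ℝ) ^ b l) (n l) = 0 := by
    intro b hb hbe
    have hdeg : b.degree = e.degree := by
      by_contra hne
      exact MvPolynomial.mem_support_iff.1 hb (hG.coeff_eq_zero (he ▸ hne))
    obtain ⟨l, hl⟩ : ∃ l, b l < e l := by
      by_contra! hcon
      refine hbe (Finsupp.ext fun l => ?_)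
      rw [Finsupp.degree_eq_sum, Finsupp.degree_eq_sum] at hdeg
      exact ((Finset.sum_eq_sum_iff_of_le fun i _ => hcon i).1 hdeg.symm l
        (Finset.mem_univ l)).symm
    refine Finset.prod_eq_zero (Finset.mem_univ l) ?_
    rw [fwdDiff_iter_comp_natCast (e l) (fun x => x ^ b l), fwdDiff_iter_pow_eq_zero_of_lt hl]
    rfl
  rw [hfun, mixedDiff_finset_sum, Finset.sum_apply]
  have hprod : ∀ b : Fin r →₀ ℕ, mixedDiff 1 (Finsupp.toMultiset e).toList
      (fun n => ∏ l, (fun x : ℕ => (x : ℝ) ^ b l) (n l)) n =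
        ∏ l, (fwdDiff 1)^[e l] (fun x : ℕ => (x : ℝ) ^ b l) (n l) := fun b => by
    rw [mixedDiff_prod _ fun l (x : ℕ) => (x : ℝ) ^ b l]
    simp only [hcount]
  simp only [mixedDiff_const_smul, Pi.smul_apply, smul_eq_mul]
  simp only [hprod]
  rw [Finset.sum_eq_single e]
  · congr 1
    refine Finset.prod_congr rfl fun l _ => ?_
    rw [fwdDiff_iter_comp_natCast (e l) (fun x => x ^ e l), fwdDiff_iter_eq_factorial]
    simp
  · intro b hb hbe
    rw [hterm b hb hbe, mul_zero]
  · intro h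
    rw [MvPolynomial.notMem_support_iff.1 h, zero_mul]

end MixedDiff

section HilbertFunction

/-- A nonnegative sequence each of whose iterated differences is eventually nonnegative. -/
def EventuallyAbsMono (u : ℕ → ℝ) : Prop :=
  (∀ x, 0 ≤ u x) ∧ ∀ k, ∃ a, ∀ x, a ≤ x → 0 ≤ (fwdDiff 1)^[k] u x

/-- The operator shifting a sequence to the right by `k`. -/
def shiftRight (k : ℕ) : (ℕ → ℝ) →ₗ[ℝ] (ℕ → ℝ) where
  toFun u x := if k ≤ x then u (x - k) else 0
  map_add' u v := by funext x; by_cases h : k ≤ x <;> simp [h]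
  map_smul' a u := by funext x; by_cases h : k ≤ x <;> simp [h]

/-- The operator of partial sums. -/
def partialSum : (ℕ → ℝ) →ₗ[ℝ] (ℕ → ℝ) where
  toFun u x := ∑ j ∈ Finset.range (x + 1), u j
  map_add' u v := by funext x; simp [Finset.sum_add_distrib]
  map_smul' a u := by funext x; simp [Finset.mul_sum]

lemma EventuallyAbsMono.shiftRight {u : ℕ → ℝ} (hu : EventuallyAbsMono u) (k : ℕ) :
    EventuallyAbsMono (shiftRight k u) := by
  refine ⟨fun x => ?_, fun j => ?_⟩
  · by_cases h : k ≤ x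
    · simpa [_root_.shiftRight, h] using hu.1 _
    · simp [_root_.shiftRight, h]
  · obtain ⟨a, ha⟩ := hu.2 j
    refine ⟨a + k, fun x hx => ?_⟩
    have h := fwdDiff_iter_comp_add 1 (_root_.shiftRight k u) k j (x - k)
    have hs : (fun y => _root_.shiftRight k u (y + k)) = u := by
      funext y
      simp [_root_.shiftRight]
    rw [hs, Nat.sub_add_cancel (by omega)] at h
    rw [← h]
    exact ha _ (by omega)

lemma EventuallyAbsMono.partialSum {u : ℕ → ℝ} (hu : EventuallyAbsMono u) :
    EventuallyAbsMono (partialSum u) := by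
  have h0 : ∀ x, 0 ≤ _root_.partialSum u x := fun x => by
    simpa [_root_.partialSum] using Finset.sum_nonneg fun j _ => hu.1 j
  refine ⟨h0, fun j => ?_⟩
  cases j with
  | zero => exact ⟨0, fun x _ => h0 x⟩
  | succ j =>
    obtain ⟨a, ha⟩ := hu.2 j
    refine ⟨a, fun x hx => ?_⟩
    have hd : fwdDiff 1 (_root_.partialSum u) = fun x => u (x + 1) := by
      funext x
      simp [fwdDiff, _root_.partialSum, Finset.sum_range_succ]
    rw [Function.iterate_succ_apply, hd, fwdDiff_iter_comp_add]
    exact ha _ (by omega)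

lemma eventuallyAbsMono_indicator_zero : EventuallyAbsMono fun x => if x = 0 then 1 else 0 := by
  refine ⟨fun x => by positivity, fun k => ⟨1, fun x hx => ?_⟩⟩
  have h := fwdDiff_iter_comp_add 1 (fun x : ℕ => if x = 0 then (1 : ℝ) else 0) 1 k (x - 1)
  rw [Nat.sub_add_cancel hx] at h
  rw [← h]
  have hz : (fun y : ℕ => if y + 1 = 0 then (1 : ℝ) else 0) = fun _ => 0 := by
    funext y
    simp
  rw [hz, fwdDiff_iter_eq_sum_shift]
  simp

/-- Finite sums of products of eventually absolutely monotone sequences, one in each variable. -/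
def absMonoSums (r : ℕ) : AddSubmonoid ((Fin r → ℕ) → ℝ) :=
  AddSubmonoid.closure {f | ∃ u : Fin r → ℕ → ℝ,
    (∀ l, EventuallyAbsMono (u l)) ∧ f = fun n => ∏ l, u l (n l)}

variable {r : ℕ}

lemma exists_mixedDiff_nonneg {f : (Fin r → ℕ) → ℝ} (hf : f ∈ absMonoSums r)
    (ls : List (Fin r)) : ∃ a, ∀ n, a ≤ n → 0 ≤ mixedDiff 1 ls f n := by
  induction hf using AddSubmonoid.closure_induction with
  | mem f hf =>
    obtain ⟨u, hu, rfl⟩ := hf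
    choose a ha using fun l => (hu l).2 (ls.count l)
    refine ⟨a, fun n hn => ?_⟩
    rw [mixedDiff_prod]
    exact Finset.prod_nonneg fun l _ => ha l _ (hn l)
  | zero => exact ⟨0, fun n _ => by simp [mixedDiff_zero]⟩
  | add f g _ _ hf hg =>
    obtain ⟨a, ha⟩ := hf
    obtain ⟨b, hb⟩ := hg
    refine ⟨a ⊔ b, fun n hn => ?_⟩
    rw [mixedDiff_add]
    exact add_nonneg (ha n (le_sup_left.trans hn)) (hb n (le_sup_right.trans hn))

lemma absMonoSums_apply_coord (T : (ℕ → ℝ) →ₗ[ℝ] (ℕ → ℝ))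
    (hT : ∀ u, EventuallyAbsMono u → EventuallyAbsMono (T u)) (i : Fin r)
    {f : (Fin r → ℕ) → ℝ} (hf : f ∈ absMonoSums r) :
    (fun n => T (fun x => f (Function.update n i x)) (n i)) ∈ absMonoSums r := by
  induction hf using AddSubmonoid.closure_induction with
  | mem f hf =>
    obtain ⟨u, hu, rfl⟩ := hf
    refine AddSubmonoid.subset_closure ⟨Function.update u i (T (u i)), fun l => ?_, ?_⟩
    · by_cases h : l = i
      · subst h
        simpa using hT _ (hu l)
      · simpa [h] using hu l
    · funext n
      have h1 : (fun x => ∏ l, u l (Function.update n i x l)) =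
          (∏ l ∈ Finset.univ.erase i, u l (n l)) • u i := by
        funext x
        rw [← Finset.mul_prod_erase Finset.univ _ (Finset.mem_univ i), Pi.smul_apply, smul_eq_mul,
          mul_comm, Function.update_self]
        congr 1
        exact Finset.prod_congr rfl fun l hl => by simp [Finset.ne_of_mem_erase hl]
      have h2 : ∏ l ∈ Finset.univ.erase i, Function.update u i (T (u i)) l (n l) =
          ∏ l ∈ Finset.univ.erase i, u l (n l) :=
        Finset.prod_congr rfl fun l hl => by simp [Finset.ne_of_mem_erase hl]
      rw [h1, map_smul, ← Finset.mul_prod_erase Finset.univ _ (Finset.mem_univ i), h2]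
      simp [mul_comm]
  | zero =>
    have : (fun n : Fin r → ℕ =>
        T (fun x => (0 : (Fin r → ℕ) → ℝ) (Function.update n i x)) (n i)) = 0 := by
      funext n
      exact congrFun (map_zero T) (n i)
    rw [this]
    exact zero_mem _
  | add f g _ _ hf hg =>
    have : (fun n : Fin r → ℕ => T (fun x => (f + g) (Function.update n i x)) (n i)) =
        (fun n => T (fun x => f (Function.update n i x)) (n i)) +
          fun n => T (fun x => g (Function.update n i x)) (n i) := by
      funext n
      exact congrFun (map_add T (fun x => f (Function.update n i x))
        fun x => g (Function.update n i x)) (n i)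
    rw [this]
    exact add_mem hf hg

lemma exists_forall_eq_of_antitone_isLowerSet {α : Type*} [Preorder α] [WellQuasiOrderedLE α]
    {D : ℕ → Set α} (hD : Antitone D) (hl : ∀ k, IsLowerSet (D k)) :
    ∃ a, ∀ k, a ≤ k → D k = D a := by
  by_contra! hcon
  have hex : ∀ a, ∃ k, a ≤ k ∧ ∃ x, x ∈ D a ∧ x ∉ D k := fun a => by
    obtain ⟨k, hk, hne⟩ := hcon a
    exact ⟨k, hk, Set.not_subset.1 fun h => hne ((hD hk).antisymm h)⟩
  choose φ hφ x hx hx' using hex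
  have hmono : Monotone fun j => φ^[j] 0 := monotone_nat_of_le_succ fun j => by
    rw [Function.iterate_succ_apply']
    exact hφ _
  obtain ⟨i, j, hij, hle⟩ := wellQuasiOrdered_le (α := α) fun j => x (φ^[j] 0)
  refine hx' (φ^[i] 0) ?_
  rw [← Function.iterate_succ_apply' φ]
  exact hl _ hle (hD (hmono (Nat.succ_le_of_lt hij)) (hx _))

/-- The multidegree of an exponent vector, for variables coloured by `c`; uncoloured variables
have degree zero. -/
def colorDeg {N : ℕ} (c : Fin N → Option (Fin r)) (y : Fin N → ℕ) (l : Fin r) : ℕ :=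
  ∑ j, if c j = some l then y j else 0

lemma colorDeg_cons {N : ℕ} (c : Fin (N + 1) → Option (Fin r)) (k : ℕ) (x : Fin N → ℕ)
    (l : Fin r) :
    colorDeg c (Fin.cons k x) l =
      (if c 0 = some l then k else 0) + colorDeg (fun j => c j.succ) x l := by
  simp [colorDeg, Fin.sum_univ_succ]

lemma ncard_eq_sum_slices {N : ℕ} {E : Set (Fin (N + 1) → ℕ)} (hE : E.Finite) {m : ℕ}
    (hm : ∀ y ∈ E, y 0 < m) :
    E.ncard = ∑ k ∈ Finset.range m, {x : Fin N → ℕ | Fin.cons k x ∈ E}.ncard := by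
  classical
  rw [Set.ncard_eq_toFinset_card _ hE,
    Finset.card_eq_sum_card_fiberwise (f := fun y => y 0) (t := Finset.range m)
      fun y hy => by simpa using hm y (by simpa using hy)]
  refine Finset.sum_congr rfl fun k _ => ?_
  rw [← Set.ncard_coe_finset, ← Set.ncard_image_of_injective _
    (Fin.cons_right_injective (α := fun _ : Fin (N + 1) => ℕ) k)]
  congr 1 with y
  simp only [Finset.coe_filter, Set.Finite.mem_toFinset, Set.mem_ofPred_eq, Set.mem_image]
  constructor
  · rintro ⟨hy, rfl⟩
    exact ⟨Fin.tail y, by simpa [Fin.cons_self_tail] using hy, Fin.cons_self_tail y⟩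
  · rintro ⟨x, hx, rfl⟩
    exact ⟨hx, rfl⟩

theorem hilbertFunction_mem_absMonoSums {N : ℕ} (c : Fin N → Option (Fin r))
    {D : Set (Fin N → ℕ)} (hD : IsLowerSet D) (hfin : ∀ n, {y ∈ D | colorDeg c y = n}.Finite) :
    (fun n => ({y ∈ D | colorDeg c y = n}.ncard : ℝ)) ∈ absMonoSums r := by
  induction N with
  | zero =>
    rcases D.eq_empty_or_nonempty with rfl | ⟨y, hy⟩
    · have : (fun n : Fin r → ℕ =>
          ({y ∈ (∅ : Set (Fin 0 → ℕ)) | colorDeg c y = n}.ncard : ℝ)) = 0 := by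
        funext n
        simp
      rw [this]
      exact zero_mem _
    · refine AddSubmonoid.subset_closure
        ⟨fun _ x => if x = 0 then 1 else 0, fun _ => eventuallyAbsMono_indicator_zero, ?_⟩
      funext n
      rw [Finset.prod_ite_zero]
      by_cases hn : n = 0
      · subst hn
        have : {z ∈ D | colorDeg c z = 0} = {y} := by
          ext z
          simp only [Set.mem_ofPred_eq, Set.mem_singleton_iff, Subsingleton.elim z y, hy,
            true_and, iff_true]
          funext l
          simp [colorDeg]
        simp [this]
      · have : {z ∈ D | colorDeg c z = n} = ∅ := by
          ext z
          simp only [Set.mem_ofPred_eq, Set.mem_empty_iff_false, iff_false, not_and]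
          rintro - rfl
          exact hn (funext fun l => by simp [colorDeg])
        rw [this, if_neg]
        · simp
        · exact fun h => hn (funext fun l => h l (Finset.mem_univ l))
  | succ N ih =>
    set c' : Fin N → Option (Fin r) := fun j => c j.succ with hc'
    set S : ℕ → Set (Fin N → ℕ) := fun k => {x | Fin.cons k x ∈ D} with hS
    have hcons : ∀ {k k' : ℕ} {x x' : Fin N → ℕ}, k ≤ k' → x ≤ x' →
        (Fin.cons k x : Fin (N + 1) → ℕ) ≤ Fin.cons k' x' :=
      fun hk hx => Fin.cons_le_cons.2 ⟨hk, hx⟩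
    have hSl : ∀ k, IsLowerSet (S k) := fun k x y hyx hx => hD (hcons le_rfl hyx) hx
    have hSa : Antitone S := fun k k' hk x hx => hD (hcons hk le_rfl) hx
    obtain ⟨a, ha⟩ := exists_forall_eq_of_antitone_isLowerSet hSa hSl
    have hSfin : ∀ k n, {x ∈ S k | colorDeg c' x = n}.Finite := fun k n => by
      have hinj := Fin.cons_right_injective (α := fun _ : Fin (N + 1) => ℕ) k
      refine Set.Finite.of_finite_image ?_ hinj.injOn
      refine (hfin fun l => (if c 0 = some l then k else 0) + n l).subset ?_
      rintro _ ⟨x, ⟨hx, rfl⟩, rfl⟩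
      exact ⟨hx, funext fun l => colorDeg_cons c k x l⟩
    have hmem := fun k => ih c' (hSl k) (hSfin k)
    rcases h0 : c 0 with _ | i
    · have hdeg : ∀ k x, colorDeg c (Fin.cons k x) = colorDeg c' x := fun k x => by
        funext l
        simp [colorDeg_cons, h0, hc']
      have hlt : ∀ y ∈ D, y 0 < a := by
        intro y hy
        by_contra! hay
        have hy' : Fin.tail y ∈ S (y 0) := by simpa [hS, Fin.cons_self_tail] using hy
        refine Set.infinite_of_injective_forall_mem
          (f := fun k : ℕ => (Fin.cons (y 0 + k) (Fin.tail y) : Fin (N + 1) → ℕ)) ?_ ?_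
          (hfin (colorDeg c' (Fin.tail y)))
        · intro k k' hk
          simpa using congrFun hk 0
        · intro k
          refine ⟨?_, hdeg _ _⟩
          have : Fin.tail y ∈ S (y 0 + k) := by rwa [ha _ (by omega), ← ha _ hay]
          exact this
      have hsum : (fun n => ({y ∈ D | colorDeg c y = n}.ncard : ℝ)) =
          ∑ k ∈ Finset.range a, fun n => ({x ∈ S k | colorDeg c' x = n}.ncard : ℝ) := by
        funext n
        rw [ncard_eq_sum_slices (hfin n) fun y hy => hlt y hy.1]
        simp [hdeg, hS]
      rw [hsum]
      exact sum_mem fun k _ => hmem k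
    · have hdeg : ∀ (k : ℕ) (x : Fin N → ℕ) (n : Fin r → ℕ), k ≤ n i →
          (colorDeg c (Fin.cons k x) = n ↔ colorDeg c' x = Function.update n i (n i - k)) := by
        intro k x n hk
        simp only [_root_.funext_iff, colorDeg_cons, h0, Option.some.injEq]
        refine forall_congr' fun l => ?_
        by_cases h : l = i
        · subst h
          simp only [if_true, Function.update_self, hc']
          omega
        · simp [h, Ne.symm h, hc']
      have hlt : ∀ n, ∀ y ∈ {y ∈ D | colorDeg c y = n}, y 0 < n i + 1 := by
        rintro n y ⟨-, rfl⟩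
        rw [← Fin.cons_self_tail y, colorDeg_cons, h0]
        simp only [if_true, Fin.cons_zero]
        omega
      have hsum : (fun n => ({y ∈ D | colorDeg c y = n}.ncard : ℝ)) =
          ∑ k ∈ Finset.range a, (fun n : Fin r → ℕ => shiftRight k (fun z =>
            ({x ∈ S k | colorDeg c' x = Function.update n i z}.ncard : ℝ)) (n i)) +
          fun n : Fin r → ℕ => (shiftRight a ∘ₗ partialSum) (fun z =>
            ({x ∈ S a | colorDeg c' x = Function.update n i z}.ncard : ℝ)) (n i) := by
        funext n
        have hH : (({y ∈ D | colorDeg c y = n}.ncard : ℕ) : ℝ) = ∑ k ∈ Finset.range (n i + 1),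
            ({x ∈ S k | colorDeg c' x = Function.update n i (n i - k)}.ncard : ℝ) := by
          rw [ncard_eq_sum_slices (hfin n) (hlt n), Nat.cast_sum]
          refine Finset.sum_congr rfl fun k hk => ?_
          have hk' : k ≤ n i := by simpa [Nat.lt_succ_iff] using hk
          simp only [Set.mem_ofPred_eq, hdeg k _ n hk', hS]
        rw [hH, Pi.add_apply, Finset.sum_apply]
        simp only [shiftRight, partialSum, LinearMap.coe_comp, LinearMap.coe_mk, AddHom.coe_mk,
          Function.comp_apply]
        by_cases hna : a ≤ n i
        · obtain ⟨b, hb⟩ := Nat.exists_eq_add_of_le hna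
          rw [if_pos hna, hb, add_assoc, Finset.sum_range_add]
          congr 1
          · refine Finset.sum_congr rfl fun k hk => ?_
            rw [if_pos (by have := Finset.mem_range.1 hk; omega)]
          · rw [Nat.add_sub_cancel_left, ← Finset.sum_range_reflect _ (b + 1)]
            refine Finset.sum_congr rfl fun k hk => ?_
            have := Finset.mem_range.1 hk
            rw [ha (a + _) (by omega)]
            rw [show a + b - (a + (b + 1 - 1 - k)) = k by omega]
        · rw [if_neg hna, add_zero, ← Finset.sum_filter]
          refine Finset.sum_congr ?_ fun _ _ => rfl
          ext k
          simp only [Finset.mem_range, Finset.mem_filter]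
          omega
      rw [hsum]
      refine add_mem (sum_mem fun k _ => ?_) ?_
      · exact absMonoSums_apply_coord (shiftRight k) (fun u hu => hu.shiftRight k) i (hmem k)
      · exact absMonoSums_apply_coord (shiftRight a ∘ₗ partialSum)
          (fun u hu => hu.partialSum.shiftRight a) i (hmem a)

end HilbertFunction

section Representatives

variable {r N : ℕ} {A : Type*} [AddCommMonoid A]

lemma colorDeg_add (c : Fin N → Option (Fin r)) (y z : Fin N → ℕ) :
    colorDeg c (y + z) = colorDeg c y + colorDeg c z := by
  funext l
  simp only [colorDeg, Pi.add_apply, ← Finset.sum_add_distrib]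
  exact Finset.sum_congr rfl fun j _ => by split_ifs <;> simp

/-- The values in multidegree `n` of a homomorphism on the free commutative monoid on coloured
generators. -/
def valuesInDegree (c : Fin N → Option (Fin r)) (π : (Fin N →₀ ℕ) →+ A) (n : Fin r → ℕ) : Set A :=
  {v | ∃ y : Fin N →₀ ℕ, colorDeg c y = n ∧ π y = v}

lemma add_mem_valuesInDegree {c : Fin N → Option (Fin r)} {π : (Fin N →₀ ℕ) →+ A}
    {m n : Fin r → ℕ} {v w : A} (hv : v ∈ valuesInDegree c π m) (hw : w ∈ valuesInDegree c π n) :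
    v + w ∈ valuesInDegree c π (m + n) := by
  obtain ⟨y, rfl, rfl⟩ := hv
  obtain ⟨z, rfl, rfl⟩ := hw
  exact ⟨y + z, by rw [Finsupp.coe_add, colorDeg_add], map_add π y z⟩

/-- The exponent vectors that are lexicographically minimal among those with the same multidegree
and the same value under `π`. -/
def minimalReps (c : Fin N → Option (Fin r)) (π : (Fin N →₀ ℕ) →+ A) : Set (Fin N →₀ ℕ) :=
  {y | ∀ z : Fin N →₀ ℕ, colorDeg c z = colorDeg c y → π z = π y →
    MonomialOrder.lex.toSyn y ≤ MonomialOrder.lex.toSyn z}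

lemma isLowerSet_minimalReps (c : Fin N → Option (Fin r)) (π : (Fin N →₀ ℕ) →+ A) :
    IsLowerSet (minimalReps c π) := by
  intro y y' hle hy z hdeg hπ
  obtain ⟨w, rfl⟩ := exists_add_of_le hle
  have := hy (z + w) (by simp only [Finsupp.coe_add, colorDeg_add, hdeg])
    (by simp only [map_add, hπ])
  simpa using this

lemma exists_mem_minimalReps (c : Fin N → Option (Fin r)) (π : (Fin N →₀ ℕ) →+ A)
    (y : Fin N →₀ ℕ) : ∃ z ∈ minimalReps c π, colorDeg c z = colorDeg c y ∧ π z = π y := by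
  obtain ⟨s, ⟨z, ⟨hz, hπ⟩, rfl⟩, hmin⟩ := WellFounded.has_min
    (wellFounded_lt (α := (MonomialOrder.lex (σ := Fin N)).syn))
    (MonomialOrder.lex.toSyn '' {z : Fin N →₀ ℕ | colorDeg c z = colorDeg c y ∧ π z = π y})
    ⟨_, y, ⟨rfl, rfl⟩, rfl⟩
  refine ⟨z, fun w hw hw' => not_lt.1 (hmin _ ⟨w, ⟨hw.trans hz, hw'.trans hπ⟩, rfl⟩), hz, hπ⟩

lemma injOn_minimalReps (c : Fin N → Option (Fin r)) (π : (Fin N →₀ ℕ) →+ A) (n : Fin r → ℕ) :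
    Set.InjOn π {y ∈ minimalReps c π | colorDeg c y = n} := by
  rintro y ⟨hy, hyn⟩ z ⟨hz, hzn⟩ h
  exact MonomialOrder.lex.toSyn.injective
    (le_antisymm (hy z (hzn.trans hyn.symm) h.symm) (hz y (hyn.trans hzn.symm) h))

theorem ncard_valuesInDegree_diff_mem_absMonoSums (c : Fin N → Option (Fin r))
    (π : (Fin N →₀ ℕ) →+ A) (m : Fin r → ℕ)
    (hfin : ∀ n, (valuesInDegree c π n \ valuesInDegree c π (n + m)).Finite) :
    (fun n => ((valuesInDegree c π n \ valuesInDegree c π (n + m)).ncard : ℝ)) ∈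
      absMonoSums r := by
  set D : Set (Fin N →₀ ℕ) :=
    {y ∈ minimalReps c π | π y ∉ valuesInDegree c π (colorDeg c y + m)} with hDdef
  have hD : IsLowerSet D := by
    rintro y y' hle ⟨hy, hy'⟩
    refine ⟨isLowerSet_minimalReps c π hle hy, fun hmem => hy' ?_⟩
    obtain ⟨w, rfl⟩ := exists_add_of_le hle
    rw [map_add, Finsupp.coe_add, colorDeg_add, add_right_comm]
    have hw : π w ∈ valuesInDegree c π (colorDeg c w) := ⟨w, rfl, rfl⟩
    exact add_mem_valuesInDegree hmem hw
  have himg : ∀ n, π '' {y ∈ D | colorDeg c y = n} =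
      valuesInDegree c π n \ valuesInDegree c π (n + m) := by
    intro n
    ext v
    constructor
    · rintro ⟨y, ⟨⟨-, hy⟩, rfl⟩, rfl⟩
      exact ⟨⟨y, rfl, rfl⟩, hy⟩
    · rintro ⟨⟨y, rfl, rfl⟩, hv⟩
      obtain ⟨z, hz, hdeg, hπ⟩ := exists_mem_minimalReps c π y
      exact ⟨z, ⟨⟨hz, by rwa [hdeg, hπ]⟩, hdeg⟩, hπ⟩
  have hinj : ∀ n, Set.InjOn π {y ∈ D | colorDeg c y = n} := fun n =>
    (injOn_minimalReps c π n).mono (by rintro y ⟨⟨hy, -⟩, hn⟩; exact ⟨hy, hn⟩)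
  have hDfin : ∀ n, {y ∈ D | colorDeg c y = n}.Finite := fun n =>
    Set.Finite.of_finite_image (by rw [himg]; exact hfin n) (hinj n)
  set D' : Set (Fin N → ℕ) := {y | Finsupp.equivFunOnFinite.symm y ∈ D} with hD'def
  have himg' : ∀ n, {y ∈ D' | colorDeg c y = n} =
      Finsupp.equivFunOnFinite '' {y ∈ D | colorDeg c y = n} := by
    intro n
    rw [Equiv.image_eq_preimage_symm]
    rfl
  have hmem := hilbertFunction_mem_absMonoSums c (D := D') (fun y y' hle hy => hD hle hy)
    fun n => by
      rw [himg']
      exact (hDfin n).image _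
  convert hmem using 3 with n
  rw [← himg, (hinj n).ncard_image, himg',
    Set.ncard_image_of_injective _ Finsupp.equivFunOnFinite.injective]

end Representatives

section Exponents

variable {𝕜 : Type*} [Field 𝕜] {d : ℕ}

/-- The exponents of the monomials contained in an ideal. -/
def expo (I : Ideal (MvPolynomial (Fin d) 𝕜)) : Set (Fin d →₀ ℕ) :=
  {v | monomial v (1 : 𝕜) ∈ I}

lemma expo_mono {I I' : Ideal (MvPolynomial (Fin d) 𝕜)} (h : I ≤ I') : expo I ⊆ expo I' :=
  fun _ hv => h hv

lemma isUpperSet_expo (I : Ideal (MvPolynomial (Fin d) 𝕜)) : IsUpperSet (expo I) := by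
  intro v w hle hv
  obtain ⟨u, rfl⟩ := exists_add_of_le hle
  have : monomial (v + u) (1 : 𝕜) = monomial v 1 * monomial u 1 := by simp [monomial_mul]
  rw [expo, Set.mem_ofPred_eq, this]
  exact I.mul_mem_right _ hv

lemma mem_expo_span {S : Set (Fin d →₀ ℕ)} {v : Fin d →₀ ℕ} :
    v ∈ expo (Ideal.span ((fun m => monomial m (1 : 𝕜)) '' S)) ↔ ∃ s ∈ S, s ≤ v := by
  classical
  rw [expo, Set.mem_ofPred_eq, mem_ideal_span_monomial_image, support_monomial,
    if_neg one_ne_zero]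
  simp

lemma IsMonomialIdeal.mem_iff {I : Ideal (MvPolynomial (Fin d) 𝕜)} (hI : IsMonomialIdeal I)
    {p : MvPolynomial (Fin d) 𝕜} : p ∈ I ↔ ∀ v ∈ p.support, v ∈ expo I := by
  obtain ⟨S, rfl⟩ := hI
  simp only [mem_expo_span, mem_ideal_span_monomial_image]

lemma isMonomialIdeal_top : IsMonomialIdeal (⊤ : Ideal (MvPolynomial (Fin d) 𝕜)) :=
  ⟨{0}, by
    rw [Set.image_singleton, monomial_zero', C_1, Ideal.span_singleton_one]⟩

lemma IsMonomialIdeal.mul {I I' : Ideal (MvPolynomial (Fin d) 𝕜)} (hI : IsMonomialIdeal I)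
    (hI' : IsMonomialIdeal I') : IsMonomialIdeal (I * I') := by
  obtain ⟨S, rfl⟩ := hI
  obtain ⟨S', rfl⟩ := hI'
  refine ⟨S + S', ?_⟩
  rw [Ideal.span_mul_span', ← Set.image2_mul, ← Set.image2_add, Set.image2_image_left,
    Set.image2_image_right, Set.image_image2]
  simp [monomial_mul]

lemma IsMonomialIdeal.pow {I : Ideal (MvPolynomial (Fin d) 𝕜)} (hI : IsMonomialIdeal I) (k : ℕ) :
    IsMonomialIdeal (I ^ k) := by
  induction k with
  | zero => simpa using isMonomialIdeal_top
  | succ k ih => rw [pow_succ]; exact ih.mul hI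

lemma IsMonomialIdeal.prod {ι : Type*} (T : Finset ι)
    {I : ι → Ideal (MvPolynomial (Fin d) 𝕜)} (hI : ∀ i, IsMonomialIdeal (I i)) :
    IsMonomialIdeal (∏ i ∈ T, I i) :=
  Finset.prod_induction _ IsMonomialIdeal (fun _ _ => IsMonomialIdeal.mul)
    (by simpa using isMonomialIdeal_top) fun i _ => hI i

lemma finrank_quotient_eq_ncard {I : Ideal (MvPolynomial (Fin d) 𝕜)} (hI : IsMonomialIdeal I) :
    Module.finrank 𝕜 (MvPolynomial (Fin d) 𝕜 ⧸ I) = (expo I)ᶜ.ncard := by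
  let φ : MvPolynomial (Fin d) 𝕜 →ₗ[𝕜] (((expo I)ᶜ : Set (Fin d →₀ ℕ)) →₀ 𝕜) :=
    Finsupp.lsubtypeDomain (expo I)ᶜ ∘ₗ (basisMonomials (Fin d) 𝕜).repr.toLinearMap
  have hφ : ∀ p v, φ p v = coeff v.1 p := fun p v => rfl
  have hsurj : Function.Surjective φ := by
    intro q
    refine ⟨(basisMonomials (Fin d) 𝕜).repr.symm (q.mapDomain Subtype.val), ?_⟩
    simp only [φ, LinearMap.comp_apply, LinearEquiv.coe_coe, LinearEquiv.apply_symm_apply]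
    ext v
    exact Finsupp.mapDomain_apply Subtype.val_injective q v
  have hker : LinearMap.ker φ = LinearMap.ker (Ideal.Quotient.mkₐ 𝕜 I).toLinearMap := by
    ext p
    have : p ∈ LinearMap.ker (Ideal.Quotient.mkₐ 𝕜 I).toLinearMap ↔ p ∈ I := by
      rw [LinearMap.mem_ker]
      exact Ideal.Quotient.eq_zero_iff_mem
    rw [this, hI.mem_iff, LinearMap.mem_ker, Finsupp.ext_iff]
    simp only [hφ, Finsupp.coe_zero, Pi.zero_apply, Subtype.forall, mem_support_iff,
      Set.mem_compl_iff]
    exact forall_congr' fun v => by tauto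
  have e : (MvPolynomial (Fin d) 𝕜 ⧸ I) ≃ₗ[𝕜] (((expo I)ᶜ : Set (Fin d →₀ ℕ)) →₀ 𝕜) :=
    (LinearMap.quotKerEquivOfSurjective (Ideal.Quotient.mkₐ 𝕜 I).toLinearMap
      (Ideal.Quotient.mkₐ_surjective 𝕜 I)).symm ≪≫ₗ
    Submodule.quotEquivOfEq _ _ hker.symm ≪≫ₗ LinearMap.quotKerEquivOfSurjective φ hsurj
  rw [e.finrank_eq, Module.finrank, rank_finsupp_self, Cardinal.toNat_lift, ← Nat.card,
    Nat.card_coe_set_eq]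

/-- Ideals containing a power of the irrelevant ideal. -/
def ContainsIrrelevantPow (I : Ideal (MvPolynomial (Fin d) 𝕜)) : Prop :=
  ∃ k : ℕ, mId 𝕜 d ^ k ≤ I

lemma containsIrrelevantPow_one : ContainsIrrelevantPow (1 : Ideal (MvPolynomial (Fin d) 𝕜)) :=
  ⟨0, by simp⟩

lemma ContainsIrrelevantPow.mul {I I' : Ideal (MvPolynomial (Fin d) 𝕜)}
    (hI : ContainsIrrelevantPow I) (hI' : ContainsIrrelevantPow I') :
    ContainsIrrelevantPow (I * I') := by
  obtain ⟨k, hk⟩ := hI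
  obtain ⟨k', hk'⟩ := hI'
  exact ⟨k + k', by rw [pow_add]; exact Ideal.mul_mono hk hk'⟩

lemma ContainsIrrelevantPow.pow {I : Ideal (MvPolynomial (Fin d) 𝕜)}
    (hI : ContainsIrrelevantPow I) (k : ℕ) : ContainsIrrelevantPow (I ^ k) := by
  induction k with
  | zero => simpa using containsIrrelevantPow_one
  | succ k ih => rw [pow_succ]; exact ih.mul hI

lemma ContainsIrrelevantPow.prod {ι : Type*} (T : Finset ι)
    {I : ι → Ideal (MvPolynomial (Fin d) 𝕜)} (hI : ∀ i, ContainsIrrelevantPow (I i)) :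
    ContainsIrrelevantPow (∏ i ∈ T, I i) :=
  Finset.prod_induction _ ContainsIrrelevantPow (fun _ _ => ContainsIrrelevantPow.mul)
    containsIrrelevantPow_one fun i _ => hI i

lemma ContainsIrrelevantPow.finite_compl_expo {I : Ideal (MvPolynomial (Fin d) 𝕜)}
    (hI : ContainsIrrelevantPow I) : (expo I)ᶜ.Finite := by
  obtain ⟨k, hk⟩ := hI
  refine (Set.finite_Iic (Finsupp.equivFunOnFinite.symm fun _ => k)).subset fun v hv j => ?_
  by_contra! hj
  have hXm : (X j : MvPolynomial (Fin d) 𝕜) ∈ mId 𝕜 d := Ideal.subset_span ⟨j, rfl⟩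
  have hX : X j ^ k ∈ I := hk (Ideal.pow_mem_pow hXm k)
  rw [X_pow_eq_monomial] at hX
  exact hv (isUpperSet_expo I (Finsupp.single_le_iff.2 (by simpa using hj.le)) hX)

lemma finrank_quotient_anti {I I' : Ideal (MvPolynomial (Fin d) 𝕜)} (hI : IsMonomialIdeal I)
    (hI' : IsMonomialIdeal I') (hc : ContainsIrrelevantPow I) (h : I ≤ I') :
    Module.finrank 𝕜 (MvPolynomial (Fin d) 𝕜 ⧸ I') ≤
      Module.finrank 𝕜 (MvPolynomial (Fin d) 𝕜 ⧸ I) := by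
  rw [finrank_quotient_eq_ncard hI, finrank_quotient_eq_ncard hI']
  exact Set.ncard_le_ncard (Set.compl_subset_compl.2 (expo_mono h)) hc.finite_compl_expo

/-- A monomial form of Lech's inequality. -/
theorem finrank_quotient_pow_le {I : Ideal (MvPolynomial (Fin d) 𝕜)} (hI : IsMonomialIdeal I)
    (hc : ContainsIrrelevantPow I) {m : ℕ} (hm : 0 < m) :
    Module.finrank 𝕜 (MvPolynomial (Fin d) 𝕜 ⧸ I ^ m) ≤
      m ^ d * Module.finrank 𝕜 (MvPolynomial (Fin d) 𝕜 ⧸ I) := by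
  rw [finrank_quotient_eq_ncard hI, finrank_quotient_eq_ncard (hI.pow m)]
  let fl : (Fin d →₀ ℕ) → (Fin d →₀ ℕ) := fun v => Finsupp.equivFunOnFinite.symm fun j => v j / m
  let rem : (Fin d →₀ ℕ) → (Fin d → Fin m) := fun v j => ⟨v j % m, Nat.mod_lt _ hm⟩
  have hinj : Function.Injective fun v => (rem v, fl v) := by
    intro v w h
    ext j
    have h1 : v j % m = w j % m := congrArg Fin.val (congrFun (Prod.ext_iff.1 h).1 j)
    have h2 : v j / m = w j / m := DFunLike.congr_fun (Prod.ext_iff.1 h).2 j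
    rw [← Nat.div_add_mod (v j) m, h1, h2, Nat.div_add_mod]
  have hsub : (fun v => (rem v, fl v)) '' (expo (I ^ m))ᶜ ⊆ Set.univ ×ˢ (expo I)ᶜ := by
    rintro _ ⟨v, hv, rfl⟩
    refine ⟨Set.mem_univ _, fun hfl => hv ?_⟩
    have hpow : m • fl v ∈ expo (I ^ m) := by
      have := Ideal.pow_mem_pow hfl m
      rwa [monomial_pow, one_pow] at this
    refine isUpperSet_expo _ (fun j => ?_) hpow
    simpa [fl] using Nat.mul_div_le (v j) m
  rw [← Set.ncard_image_of_injective _ hinj]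
  refine (Set.ncard_le_ncard hsub (Set.finite_univ.prod hc.finite_compl_expo)).trans ?_
  rw [Set.ncard_prod, Set.ncard_univ]
  simp

end Exponents

section Powers

variable {𝕜 : Type*} [Field 𝕜] {d r : ℕ}

lemma IsMonomialIdeal.exists_finset {I : Ideal (MvPolynomial (Fin d) 𝕜)}
    (hI : IsMonomialIdeal I) : ∃ S : Finset (Fin d →₀ ℕ),
      I = Ideal.span ((fun m => monomial m (1 : 𝕜)) '' (S : Set (Fin d →₀ ℕ))) := by
  classical
  obtain ⟨S, rfl⟩ := hI
  obtain ⟨T, hT, hspan⟩ := Submodule.fg_span_iff_fg_span_finset_subset _ |>.1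
    (IsNoetherian.noetherian (Ideal.span ((fun m => monomial m (1 : 𝕜)) '' S)))
  obtain ⟨S', -, rfl⟩ := Finset.subset_set_image_iff.1 hT
  exact ⟨S', by simpa using hspan⟩

/-- The exponents of the products of powers of finitely many monomial ideals are the values of a
homomorphism on coloured generators. -/
theorem exists_expo_prod_pow_eq {L : Fin r → Ideal (MvPolynomial (Fin d) 𝕜)}
    (hL : ∀ l, IsMonomialIdeal (L l)) :
    ∃ (N : ℕ) (c : Fin N → Option (Fin r)) (π : (Fin N →₀ ℕ) →+ (Fin d →₀ ℕ)),
      ∀ n : Fin r → ℕ, expo (∏ l, L l ^ n l) = valuesInDegree c π n := by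
  classical
  choose S hS using fun l => (hL l).exists_finset
  let σ : Type := (Σ l, S l) ⊕ Fin d
  let e : Fin (Fintype.card σ) ≃ σ := (Fintype.equivFin σ).symm
  let g : σ → Fin d →₀ ℕ := Sum.elim (fun s => s.2.1) fun j => Finsupp.single j 1
  let col : σ → Option (Fin r) := Sum.elim (fun s => some s.1) fun _ => none
  let c := col ∘ e
  let π : (Fin (Fintype.card σ) →₀ ℕ) →+ (Fin d →₀ ℕ) :=
    (Finsupp.linearCombination ℕ (g ∘ e)).toAddMonoidHom
  have hπ : ∀ j, π (Finsupp.single j 1) = g (e j) := fun j => by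
    simp [π, Finsupp.linearCombination_single]
  have hdeg : ∀ j l, colorDeg c (Finsupp.single j 1 : Fin (Fintype.card σ) →₀ ℕ) l =
      if col (e j) = some l then 1 else 0 := fun j l => by
    rw [colorDeg, Finset.sum_eq_single j]
    · simp [c]
    · intro i _ hij
      simp [Ne.symm hij]
    · simp
  have hgen : ∀ l, ∀ s ∈ S l, s ∈ valuesInDegree c π (Pi.single l 1) := fun l s hs => by
    refine ⟨Finsupp.single (e.symm (Sum.inl ⟨l, s, hs⟩)) 1, funext fun l' => ?_, ?_⟩
    · simp [hdeg, col, Pi.single_apply, eq_comm]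
    · simp [hπ, g]
  have hvar : ∀ v, v ∈ valuesInDegree c π 0 := fun v => by
    have hz : (0 : Fin d →₀ ℕ) ∈ valuesInDegree c π 0 := ⟨0, by funext l; simp [colorDeg], by simp⟩
    have hadd : ∀ v w, v ∈ valuesInDegree c π 0 → w ∈ valuesInDegree c π 0 →
        v + w ∈ valuesInDegree c π 0 := fun v w hv hw => by
      simpa using add_mem_valuesInDegree hv hw
    have hone : ∀ j, Finsupp.single j 1 ∈ valuesInDegree c π 0 := fun j =>
      ⟨Finsupp.single (e.symm (Sum.inr j)) 1, funext fun l => by simp [hdeg, col],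
        by simp [hπ, g]⟩
    induction v using Finsupp.induction_linear with
    | zero => exact hz
    | add v w hv hw => exact hadd v w hv hw
    | single j k =>
      induction k with
      | zero => simpa using hz
      | succ k ih => rw [Finsupp.single_add]; exact hadd _ _ ih (hone j)
  let T : (Fin r → ℕ) → Ideal (MvPolynomial (Fin d) 𝕜) := fun n =>
    Ideal.span ((fun m => monomial m (1 : 𝕜)) '' valuesInDegree c π n)
  have hT : ∀ n, expo (T n) = valuesInDegree c π n := fun n => by
    ext v
    rw [mem_expo_span]
    constructor
    · rintro ⟨s, hs, hle⟩
      obtain ⟨w, rfl⟩ := exists_add_of_le hle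
      simpa using add_mem_valuesInDegree hs (hvar w)
    · exact fun hv => ⟨v, hv, le_rfl⟩
  have hTmul : ∀ m n, T m * T n ≤ T (m + n) := fun m n => by
    rw [Ideal.span_mul_span', Ideal.span_le]
    rintro _ ⟨_, ⟨v, hv, rfl⟩, _, ⟨w, hw, rfl⟩, rfl⟩
    refine Ideal.subset_span ⟨v + w, add_mem_valuesInDegree hv hw, ?_⟩
    simp [monomial_mul]
  have hTone : (1 : Ideal (MvPolynomial (Fin d) 𝕜)) ≤ T 0 := by
    rw [Ideal.one_eq_top, top_le_iff, Ideal.eq_top_iff_one]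
    exact Ideal.subset_span ⟨0, hvar 0, by simp⟩
  have hLT : ∀ l k, L l ^ k ≤ T (Pi.single l k) := fun l k => by
    induction k with
    | zero => simpa using hTone
    | succ k ih =>
      rw [pow_succ, Pi.single_add]
      refine (Ideal.mul_mono ih ?_).trans (hTmul _ _)
      rw [hS l]
      exact Ideal.span_mono (Set.image_mono fun s hs => hgen l s hs)
  have hprod : ∀ (U : Finset (Fin r)) (n : Fin r → ℕ),
      ∏ l ∈ U, L l ^ n l ≤ T (∑ l ∈ U, Pi.single l (n l)) := fun U n => by
    induction U using Finset.induction_on with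
    | empty => simpa using hTone
    | insert l U hl ih =>
      rw [Finset.prod_insert hl, Finset.sum_insert hl]
      exact (Ideal.mul_mono (hLT _ _) ih).trans (hTmul _ _)
  refine ⟨_, c, π, fun n => Set.Subset.antisymm ?_ ?_⟩
  · rw [← hT]
    refine expo_mono ?_
    have := hprod Finset.univ n
    rwa [Finset.univ_sum_single] at this
  · rintro _ ⟨y, rfl, rfl⟩
    have hone : ∀ j, π (Finsupp.single j 1) ∈
        expo (∏ l, L l ^ colorDeg c (Finsupp.single j 1 : Fin (Fintype.card σ) →₀ ℕ) l) := by
      intro j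
      simp only [hdeg, hπ]
      rcases e j with ⟨l, s, hs⟩ | j
      · have : ∏ l', L l' ^ (if col (Sum.inl ⟨l, s, hs⟩) = some l' then 1 else 0) = L l := by
          rw [Finset.prod_eq_single l]
          · simp [col]
          · intro l' _ hl'
            simp [col, Ne.symm hl']
          · simp
        rw [this, hS l, mem_expo_span]
        exact ⟨s, hs, le_rfl⟩
      · simp [col, expo, Ideal.top_pow]
    have hadd : ∀ y z : Fin (Fintype.card σ) →₀ ℕ, π y ∈ expo (∏ l, L l ^ colorDeg c y l) →
        π z ∈ expo (∏ l, L l ^ colorDeg c z l) →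
        π (y + z) ∈ expo (∏ l, L l ^ colorDeg c (y + z : Fin (Fintype.card σ) →₀ ℕ) l) := by
      intro y z hy hz
      have := Ideal.mul_mem_mul hy hz
      rw [monomial_mul, mul_one, ← Finset.prod_mul_distrib] at this
      simp only [← pow_add] at this
      rw [map_add, Finsupp.coe_add, colorDeg_add]
      exact this
    have hz : π 0 ∈ expo (∏ l, L l ^ colorDeg c (0 : Fin (Fintype.card σ) →₀ ℕ) l) := by
      simp [colorDeg, expo, Ideal.top_pow]
    induction y using Finsupp.induction_linear with
    | zero => exact hz
    | add y z hy hz => exact hadd y z hy hz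
    | single j k =>
      induction k with
      | zero => simpa using hz
      | succ k ih => rw [Finsupp.single_add]; exact hadd _ _ ih (hone j)

theorem fwdDiff_finrank_mem_absMonoSums {L : Fin r → Ideal (MvPolynomial (Fin d) 𝕜)}
    (hL : ∀ l, IsMonomialIdeal (L l)) (hc : ∀ l, ContainsIrrelevantPow (L l)) (i : Fin r) :
    fwdDiff (Pi.single i 1) (fun n : Fin r → ℕ =>
      (Module.finrank 𝕜 (MvPolynomial (Fin d) 𝕜 ⧸ ∏ l, L l ^ n l) : ℝ)) ∈ absMonoSums r := by
  obtain ⟨N, c, π, h⟩ := exists_expo_prod_pow_eq hL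
  have hcn : ∀ n : Fin r → ℕ, (expo (∏ l, L l ^ n l))ᶜ.Finite := fun n =>
    (ContainsIrrelevantPow.prod Finset.univ fun l => (hc l).pow (n l)).finite_compl_expo
  have hdiff : ∀ n : Fin r → ℕ,
      valuesInDegree c π n \ valuesInDegree c π (n + Pi.single i 1) ⊆
        (expo (∏ l, L l ^ (n + Pi.single i 1 : Fin r → ℕ) l))ᶜ := fun n => by
    rw [h]
    exact fun v hv => hv.2
  convert ncard_valuesInDegree_diff_mem_absMonoSums c π (Pi.single i 1)
    fun n => (hcn _).subset (hdiff n) using 2 with n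
  have hle : ∏ l, L l ^ (n + Pi.single i 1 : Fin r → ℕ) l ≤ ∏ l, L l ^ n l :=
    Finset.prod_le_prod' fun l _ => Ideal.pow_le_pow_right (by simp)
  have hsub := Set.compl_subset_compl.2 (expo_mono hle)
  rw [fwdDiff, finrank_quotient_eq_ncard (IsMonomialIdeal.prod _ fun l => (hL l).pow _),
    finrank_quotient_eq_ncard (IsMonomialIdeal.prod _ fun l => (hL l).pow _), ← h, ← h,
    ← Set.ncard_sdiff_add_ncard_of_subset hsub (hcn _), compl_sdiff_compl]
  push_cast
  ring

end Powers

lemma IsGradedFamily.pow_le {R : Type*} [CommSemiring R] {I : ℕ → Ideal R}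
    (hI : IsGradedFamily I) (a k : ℕ) : I a ^ k ≤ I (a * k) := by
  induction k with
  | zero => simp [hI.1]
  | succ k ih =>
    rw [pow_succ, mul_add_one]
    exact (Ideal.mul_mono ih le_rfl).trans (hI.2 _ _)

/-- High powers of `I (k * n)` lie in powers of the single ideal `I (k * k!)` whenever `n ≤ k`. -/
lemma IsGradedFamily.pow_factorial_le {R : Type*} [CommSemiring R] {I : ℕ → Ideal R}
    (hI : IsGradedFamily I) {k n : ℕ} (hn : n ≤ k) (t : ℕ) :
    I (k * n) ^ (t * k.factorial) ≤ I (k * k.factorial) ^ (t * n) := by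
  rcases Nat.eq_zero_or_pos n with rfl | hpos
  · simp
  · obtain ⟨q, hq⟩ := Nat.dvd_factorial hpos hn
    have h := hI.pow_le (k * n) q
    rw [mul_assoc, ← hq] at h
    calc I (k * n) ^ (t * k.factorial) = (I (k * n) ^ q) ^ (t * n) := by
          rw [← pow_mul, hq]; ring_nf
      _ ≤ _ := Ideal.pow_right_mono h _

/-- **Non-negativity of mixed multiplicities in the `𝔪`-primary case.**
Any homogeneous polynomial `G` of total degree `d` that agrees with the limit
`lim_m dim_𝕜(R / J(1)_{m n₁} ⋯ J(r)_{m n_r}) / m^d` on `ℕ^r` has all of its coefficients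
non-negative (equivalently, writing `G(𝐧) = Σ_{|𝐝|=d} (a_𝐝/𝐝!) 𝐧^𝐝`, each `a_𝐝 ≥ 0`). -/
theorem statement2 {𝕜 : Type*} [Field 𝕜] (d r : ℕ) (hd : 0 < d)
    (J : Fin r → ℕ → Ideal (MvPolynomial (Fin d) 𝕜))
    (hJ : ∀ i, IsGradedFamily (J i))
    (hJmon : ∀ i n, IsMonomialIdeal (J i n))
    (hJprim : ∀ i n, 0 < n → IsMPrimary (J i n))
    (G : MvPolynomial (Fin r) ℝ)
    (hGhom : G.IsHomogeneous d)
    (hGlim : ∀ n : Fin r → ℕ,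
      Tendsto
        (fun m : ℕ =>
          (Module.finrank 𝕜 (MvPolynomial (Fin d) 𝕜 ⧸ (∏ i, J i (m * n i))) : ℝ) /
            (m : ℝ) ^ d)
        atTop
        (nhds (MvPolynomial.eval (fun i => (n i : ℝ)) G))) :
    ∀ e : Fin r →₀ ℕ, 0 ≤ G.coeff e := by
  intro e
  by_cases he : e.degree = d
  swap
  · rw [hGhom.coeff_eq_zero he]
  have hJc : ∀ i n, ContainsIrrelevantPow (J i n) := fun i n => by
    rcases Nat.eq_zero_or_pos n with rfl | hn
    · exact ⟨0, by simp [(hJ i).1]⟩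
    · exact (hJprim i n hn).2
  set ls := (Finsupp.toMultiset e).toList with hls
  obtain ⟨l, ls', hcons⟩ : ∃ l ls', ls = l :: ls' := by
    refine List.exists_cons_of_ne_nil fun hnil => ?_
    rw [hls, Multiset.toList_eq_nil] at hnil
    rw [← Finsupp.toMultiset_toFinsupp e, hnil, map_zero, map_zero] at he
    omega
  let h : ℕ → (Fin r → ℕ) → ℝ := fun k n =>
    (Module.finrank 𝕜 (MvPolynomial (Fin d) 𝕜 ⧸ ∏ i, J i (k * k.factorial) ^ n i) : ℝ)
  have hpos : ∀ k, ∃ t, 0 < t ∧ 0 ≤ mixedDiff t ls (h k) (t • 1) := fun k => by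
    obtain ⟨a, ha⟩ := exists_mixedDiff_nonneg (fwdDiff_finrank_mem_absMonoSums
      (fun i => hJmon i (k * k.factorial)) (fun i => hJc i _) l) ls'
    refine ⟨∑ i, a i + 1, by omega, ?_⟩
    refine mixedDiff_nonneg_of_one (a := a) ls ?_ fun i => ?_
    · rw [hcons]
      exact ha
    · have := Finset.single_le_sum (f := a) (fun _ _ => Nat.zero_le _) (Finset.mem_univ i)
      simp only [Pi.smul_apply, Pi.one_apply, smul_eq_mul, mul_one]
      omega
  choose t ht0 ht using hpos
  let M : ℕ → ℕ := fun k => k * k.factorial * t k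
  have hM : Tendsto M atTop atTop := tendsto_atTop_mono (fun k => by
    have := Nat.mul_pos k.factorial_pos (ht0 k)
    simp only [M, mul_assoc, id]
    exact Nat.le_mul_of_pos_right k this) tendsto_id
  let F : ℕ → (Fin r → ℕ) → ℝ := fun k => ((M k : ℝ) ^ d)⁻¹ • fun n => h k (t k • n)
  have hF0 : ∀ k, 0 ≤ mixedDiff 1 ls (F k) 1 := fun k => by
    rw [mixedDiff_const_smul, Pi.smul_apply, mixedDiff_comp_smul, smul_eq_mul]
    exact mul_nonneg (by positivity) (ht k)
  have hFlim : ∀ n, Tendsto (fun k => F k n) atTop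
      (nhds (MvPolynomial.eval (fun i => (n i : ℝ)) G)) := fun n => by
    refine tendsto_of_tendsto_of_tendsto_of_le_of_le' ((hGlim n).comp hM) (hGlim n) ?_ ?_
    · refine Eventually.of_forall fun k => ?_
      simp only [Function.comp_apply, F, Pi.smul_apply, smul_eq_mul, h, div_eq_inv_mul]
      refine mul_le_mul_of_nonneg_left (Nat.cast_le.2 ?_) (by positivity)
      refine finrank_quotient_anti (IsMonomialIdeal.prod _ fun i => (hJmon i _).pow _)
        (IsMonomialIdeal.prod _ fun i => hJmon i _)
        (ContainsIrrelevantPow.prod _ fun i => (hJc i _).pow _)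
        (Finset.prod_le_prod' fun i _ => ?_)
      simpa only [M, mul_assoc] using (hJ i).pow_le (k * k.factorial) (t k * n i)
    · filter_upwards [eventually_ge_atTop (∑ i, n i + 1)] with k hk
      have hnk : ∀ i, n i ≤ k := fun i => by
        have := Finset.single_le_sum (f := n) (fun _ _ => Nat.zero_le _) (Finset.mem_univ i)
        omega
      have hk0 : (0 : ℝ) < k := by exact_mod_cast (by omega : 0 < k)
      have hs : 0 < t k * k.factorial := Nat.mul_pos (ht0 k) k.factorial_pos
      have hmon := IsMonomialIdeal.prod Finset.univ fun i => hJmon i (k * n i)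
      have hc := ContainsIrrelevantPow.prod Finset.univ fun i => hJc i (k * n i)
      have hle : h k (t k • n) ≤ ((t k * k.factorial : ℕ) : ℝ) ^ d *
          Module.finrank 𝕜 (MvPolynomial (Fin d) 𝕜 ⧸ ∏ i, J i (k * n i)) := by
        have := (finrank_quotient_anti (hmon.pow (t k * k.factorial))
          (IsMonomialIdeal.prod Finset.univ fun i =>
            (hJmon i (k * k.factorial)).pow ((t k • n) i))
          (hc.pow _) (by
            rw [← Finset.prod_pow]
            exact Finset.prod_le_prod' fun i _ => (hJ i).pow_factorial_le (hnk i) (t k))).trans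
          (finrank_quotient_pow_le hmon hc hs)
        simp only [h]
        exact_mod_cast this
      simp only [F, Pi.smul_apply, smul_eq_mul]
      have hM0 : (0 : ℝ) < M k := by
        simp only [M, mul_assoc, mul_comm k.factorial]
        exact_mod_cast Nat.mul_pos (by omega) hs
      rw [inv_mul_le_iff₀ (pow_pos hM0 d)]
      refine hle.trans (le_of_eq ?_)
      simp only [M]
      push_cast
      field_simp
      ring
  have hlim := ge_of_tendsto' (tendsto_mixedDiff 1 ls hFlim 1) hF0
  rw [hls, mixedDiff_eval_of_isHomogeneous hGhom he] at hlim
  exact nonneg_of_mul_nonneg_left hlim (Finset.prod_pos fun l _ => by positivity)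
end
end

section
/- For every n_0 ∈ ℕ, 𝐧 = (n_1,…,n_r) ∈ ℕ^r and every m ∈ ℕ, the level set of Γ̂_{n_0,𝐧} decomposes as a Minkowski sum: π_1([Γ̂_{n_0,𝐧}]_m) = π_1([Γ̂_{n_0,𝟎}]_m) + π_1([Γ̂_{0,n_1𝐞_1}]_m) + ⋯ + π_1([Γ̂_{0,n_r𝐞_r}]_m), where the sums on the right are Minkowski sums of finite subsets of ℕ^d. -/
open Filter MvPolynomial Pointwise MeasureTheory

noncomputable section

/-- The semigroup `Γ_{n₀,𝐧} = {(𝐦,m) ∈ ℕ^d × ℕ : x^𝐦 ∈ 𝐉_{m𝐧}, |𝐦| ≤ c m (n₀+|𝐧|)}`. -/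
def GammaSet (𝕜 : Type*) [Field 𝕜] {d r : ℕ}
    (J : Fin r → ℕ → Ideal (MvPolynomial (Fin d) 𝕜)) (c n0 : ℕ) (n : Fin r → ℕ) :
    Set ((Fin d →₀ ℕ) × ℕ) :=
  {q | MvPolynomial.monomial q.1 (1 : 𝕜) ∈ ∏ i, J i (q.2 * n i) ∧
    (∑ j, q.1 j) ≤ c * q.2 * (n0 + ∑ i, n i)}

/-- The semigroup `Γ̂_{n₀,𝐧} = {(𝐦,m) : x^𝐦 ∈ I_{m n₀}𝐉_{m𝐧}, |𝐦| ≤ c m (n₀+|𝐧|)}`. -/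
def GammaHatSet (𝕜 : Type*) [Field 𝕜] {d r : ℕ}
    (I : ℕ → Ideal (MvPolynomial (Fin d) 𝕜))
    (J : Fin r → ℕ → Ideal (MvPolynomial (Fin d) 𝕜)) (c n0 : ℕ) (n : Fin r → ℕ) :
    Set ((Fin d →₀ ℕ) × ℕ) :=
  {q | MvPolynomial.monomial q.1 (1 : 𝕜) ∈ I (q.2 * n0) * ∏ i, J i (q.2 * n i) ∧
    (∑ j, q.1 j) ≤ c * q.2 * (n0 + ∑ i, n i)}

/-- The level set `π₁([S]_m)` of a subset `S ⊆ ℕ^d × ℕ`. -/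
def levelSet {d : ℕ} (S : Set ((Fin d →₀ ℕ) × ℕ)) (m : ℕ) : Set (Fin d →₀ ℕ) :=
  {q | (q, m) ∈ S}

/-- The embedding `ℕ^d × ℕ → ℝ^d × ℝ`. -/
def embedReal {d : ℕ} (q : (Fin d →₀ ℕ) × ℕ) : (Fin d → ℝ) × ℝ :=
  ((fun j => (q.1 j : ℝ)), (q.2 : ℝ))

/-- `Con(S)`: the closure of the set of all non-negative real linear combinations of
elements of `S ⊆ ℝ^d × ℝ`. -/
def coneOf {d : ℕ} (S : Set ((Fin d → ℝ) × ℝ)) : Set ((Fin d → ℝ) × ℝ) :=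
  closure {x | ∃ (k : ℕ) (a : Fin k → ℝ) (v : Fin k → (Fin d → ℝ) × ℝ),
    (∀ j, 0 ≤ a j) ∧ (∀ j, v j ∈ S) ∧ x = ∑ j, a j • v j}

/-- The Newton–Okounkov body `Δ(S) = Con(S) ∩ π^{-1}(1)` of `S ⊆ ℕ^d × ℕ`,
where `π` is the projection to the last coordinate. -/
def newtonBody {d : ℕ} (S : Set ((Fin d →₀ ℕ) × ℕ)) : Set ((Fin d → ℝ) × ℝ) :=
  {x | x ∈ coneOf (embedReal '' S) ∧ x.2 = 1}

/-- `Vol_d(Δ(S))`: the `d`-dimensional Lebesgue volume of `π₁(Δ(S))`. -/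
def volDelta {d : ℕ} (S : Set ((Fin d →₀ ℕ) × ℕ)) : ℝ :=
  (MeasureTheory.volume (Prod.fst '' newtonBody S)).toReal

/-- `IsGenByDegreeLE P p`: the ideal `P` is generated by monomials of degree at most `p`. -/
def IsGenByDegreeLE {σ R : Type*} [CommSemiring R] (P : Ideal (MvPolynomial σ R)) (p : ℕ) : Prop :=
  ∃ S : Set (σ →₀ ℕ), (∀ a ∈ S, a.degree ≤ p) ∧
    P = Ideal.span ((fun a => monomial a (1 : R)) '' S)

/-- The exponents of the monomials of degree at most `p` in the ideal `P`. -/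
def truncExponents {σ R : Type*} [CommSemiring R] (P : Ideal (MvPolynomial σ R)) (p : ℕ) :
    Set (σ →₀ ℕ) :=
  {a | monomial a (1 : R) ∈ P ∧ a.degree ≤ p}

section

variable {σ R : Type*} [CommSemiring R]

theorem monomial_mem_span_iff [Nontrivial R] {S : Set (σ →₀ ℕ)} {a : σ →₀ ℕ} :
    monomial a (1 : R) ∈ Ideal.span ((fun s => monomial s (1 : R)) '' S) ↔ ∃ s ∈ S, s ≤ a := by
  classical
  rw [mem_ideal_span_monomial_image, support_monomial, if_neg one_ne_zero]
  simp

theorem span_monomial_mul_span_monomial (S T : Set (σ →₀ ℕ)) :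
    Ideal.span ((fun s => monomial s (1 : R)) '' S) *
      Ideal.span ((fun s => monomial s (1 : R)) '' T) =
    Ideal.span ((fun s => monomial s (1 : R)) '' (S + T)) := by
  rw [Ideal.span_mul_span']
  congr 1
  ext x
  simp only [Set.mem_mul, Set.mem_image, Set.mem_add]
  constructor
  · rintro ⟨_, ⟨s, hs, rfl⟩, _, ⟨t, ht, rfl⟩, rfl⟩
    exact ⟨s + t, ⟨s, hs, t, ht, rfl⟩, by simp [monomial_mul]⟩
  · rintro ⟨_, ⟨s, hs, t, ht, rfl⟩, rfl⟩
    exact ⟨_, ⟨s, hs, rfl⟩, _, ⟨t, ht, rfl⟩, by simp [monomial_mul]⟩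

theorem IsGenByDegreeLE.mul {P Q : Ideal (MvPolynomial σ R)} {p q : ℕ}
    (hP : IsGenByDegreeLE P p) (hQ : IsGenByDegreeLE Q q) : IsGenByDegreeLE (P * Q) (p + q) := by
  obtain ⟨S, hS, rfl⟩ := hP
  obtain ⟨T, hT, rfl⟩ := hQ
  refine ⟨S + T, ?_, span_monomial_mul_span_monomial S T⟩
  rintro _ ⟨s, hs, t, ht, rfl⟩
  simpa using add_le_add (hS s hs) (hT t ht)

theorem isGenByDegreeLE_one : IsGenByDegreeLE (1 : Ideal (MvPolynomial σ R)) 0 :=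
  ⟨{0}, by simp, by simp [Ideal.one_eq_top]⟩

theorem IsGenByDegreeLE.prod {ι : Type*} (s : Finset ι) {P : ι → Ideal (MvPolynomial σ R)}
    {p : ι → ℕ} (h : ∀ i ∈ s, IsGenByDegreeLE (P i) (p i)) :
    IsGenByDegreeLE (∏ i ∈ s, P i) (∑ i ∈ s, p i) := by
  classical
  induction s using Finset.induction_on with
  | empty => simpa using isGenByDegreeLE_one
  | insert i s hi ih =>
    rw [Finset.prod_insert hi, Finset.sum_insert hi]
    exact (h i (s.mem_insert_self i)).mul (ih fun j hj => h j (Finset.mem_insert_of_mem hj))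

/-- Truncation by degree turns products of ideals into Minkowski sums, as long as the ideals are
generated by monomials of degree at most the truncation bounds. -/
theorem truncExponents_mul [Nontrivial R] {P Q : Ideal (MvPolynomial σ R)} {p q : ℕ}
    (hP : IsGenByDegreeLE P p) (hQ : IsGenByDegreeLE Q q) :
    truncExponents (P * Q) (p + q) = truncExponents P p + truncExponents Q q := by
  obtain ⟨S, hS, rfl⟩ := hP
  obtain ⟨T, hT, rfl⟩ := hQ
  ext e
  constructor
  · rintro ⟨he, hdeg⟩
    rw [span_monomial_mul_span_monomial, monomial_mem_span_iff] at he
    obtain ⟨_, ⟨s, hs, t, ht, rfl⟩, hst⟩ := he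
    dsimp only at hst
    obtain ⟨f, rfl⟩ := le_iff_exists_add'.mp hst
    have hsp := hS s hs
    have htq := hT t ht
    simp only [map_add] at hdeg
    obtain ⟨g, hg, hgn⟩ := f.exists_le_degree_eq (min f.degree (p - s.degree)) (min_le_left _ _)
    obtain ⟨h, rfl⟩ := le_iff_exists_add.mp hg
    rw [map_add] at hgn hdeg
    refine ⟨s + g, ⟨monomial_mem_span_iff.mpr ⟨s, hs, le_self_add⟩, ?_⟩,
      t + h, ⟨monomial_mem_span_iff.mpr ⟨t, ht, le_self_add⟩, ?_⟩, ?_⟩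
    · rw [map_add]; omega
    · rw [map_add]; omega
    · dsimp only
      abel
  · rintro ⟨a, ⟨ha, hap⟩, b, ⟨hb, hbq⟩, rfl⟩
    refine ⟨?_, ?_⟩
    · simpa [monomial_mul] using Ideal.mul_mem_mul ha hb
    · simpa using add_le_add hap hbq

theorem truncExponents_one_zero [Nontrivial R] :
    truncExponents (1 : Ideal (MvPolynomial σ R)) 0 = 0 := by
  ext a
  simp [truncExponents, Ideal.one_eq_top, Finsupp.degree_eq_zero_iff]

theorem truncExponents_prod [Nontrivial R] {ι : Type*} (s : Finset ι)
    {P : ι → Ideal (MvPolynomial σ R)} {p : ι → ℕ} (h : ∀ i ∈ s, IsGenByDegreeLE (P i) (p i)) :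
    truncExponents (∏ i ∈ s, P i) (∑ i ∈ s, p i) = ∑ i ∈ s, truncExponents (P i) (p i) := by
  classical
  induction s using Finset.induction_on with
  | empty => simpa using truncExponents_one_zero
  | insert i s hi ih =>
    have hs : ∀ j ∈ s, IsGenByDegreeLE (P j) (p j) :=
      fun j hj => h j (Finset.mem_insert_of_mem hj)
    rw [Finset.prod_insert hi, Finset.sum_insert hi, Finset.sum_insert hi,
      truncExponents_mul (h i (s.mem_insert_self i)) (.prod s hs), ih hs]

end

/-- A monomial ideal containing `𝔪 ^ k` is generated by monomials of degree at most `k`. -/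
theorem IsMonomialIdeal.isGenByDegreeLE {𝕜 : Type*} [Field 𝕜] {d k : ℕ}
    {P : Ideal (MvPolynomial (Fin d) 𝕜)} (hP : IsMonomialIdeal P) (hk : mId 𝕜 d ^ k ≤ P) :
    IsGenByDegreeLE P k := by
  refine ⟨truncExponents P k, fun a ha => ha.2, le_antisymm ?_ ?_⟩
  · obtain ⟨S, rfl⟩ := hP
    rw [Ideal.span_le]
    rintro _ ⟨s, hs, rfl⟩
    rw [SetLike.mem_coe, monomial_mem_span_iff]
    obtain hsk | hks := le_total s.degree k
    · exact ⟨s, ⟨Ideal.subset_span ⟨s, hs, rfl⟩, hsk⟩, le_rfl⟩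
    · obtain ⟨g, hg, rfl⟩ := s.exists_le_degree_eq k hks
      exact ⟨g, ⟨hk ((monomial_mem_pow_idealOfVars_iff _ _ one_ne_zero).mpr le_rfl), le_rfl⟩, hg⟩
  · rw [Ideal.span_le]
    rintro _ ⟨a, ha, rfl⟩
    exact ha.1

theorem levelSet_gammaHatSet {𝕜 : Type*} [Field 𝕜] {d r : ℕ}
    (I : ℕ → Ideal (MvPolynomial (Fin d) 𝕜))
    (J : Fin r → ℕ → Ideal (MvPolynomial (Fin d) 𝕜)) (c n0 : ℕ) (n : Fin r → ℕ) (m : ℕ) :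
    levelSet (GammaHatSet 𝕜 I J c n0 n) m =
      truncExponents (I (m * n0) * ∏ i, J i (m * n i)) (c * m * (n0 + ∑ i, n i)) := by
  ext a
  simp [levelSet, GammaHatSet, truncExponents, Finsupp.degree_eq_sum]

/-- **Levelwise decomposition of `Γ̂_{n₀,𝐧}`.**
For every `n₀, 𝐧` and every level `m`, `π₁([Γ̂_{n₀,𝐧}]_m)` is the Minkowski sum of
`π₁([Γ̂_{n₀,𝟎}]_m)` and the sets `π₁([Γ̂_{0,n_i 𝐞_i}]_m)`, `1 ≤ i ≤ r`. -/
theorem statement6 {𝕜 : Type*} [Field 𝕜] (d r : ℕ) (hd : 0 < d)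
    (I : ℕ → Ideal (MvPolynomial (Fin d) 𝕜))
    (J : Fin r → ℕ → Ideal (MvPolynomial (Fin d) 𝕜)) (β c : ℕ)
    (hI : IsGradedFamily I)
    (hImon : ∀ n, IsMonomialIdeal (I n))
    (hIprim : ∀ n, 0 < n → IsMPrimary (I n))
    (hJ : ∀ i, IsGradedFamily (J i))
    (hJb : ∀ i n, IsMonomialBounded (J i n) (β * n))
    (hc : β < c)
    (hcap : ∀ (n0 : ℕ) (n : Fin r → ℕ),
      mId 𝕜 d ^ (c * (n0 + ∑ i, n i)) ⊓ (∏ i, J i (n i)) =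
        mId 𝕜 d ^ (c * (n0 + ∑ i, n i)) ⊓ (I n0 * ∏ i, J i (n i))) :
    ∀ (n0 : ℕ) (n : Fin r → ℕ) (m : ℕ),
      levelSet (GammaHatSet 𝕜 I J c n0 n) m =
        levelSet (GammaHatSet 𝕜 I J c n0 (fun _ => 0)) m +
          ∑ i : Fin r, levelSet (GammaHatSet 𝕜 I J c 0 (Pi.single i (n i))) m := by
  intro n0 n m
  have hIgen : IsGenByDegreeLE (I (m * n0)) (c * m * n0) := by
    refine (hImon _).isGenByDegreeLE ?_
    have h := hcap (m * n0) 0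
    simp only [Pi.zero_apply, (hJ _).1, Finset.sum_const_zero, add_zero, ← Ideal.one_eq_top,
      Finset.prod_const_one, mul_one] at h
    rw [Ideal.one_eq_top, inf_top_eq, ← mul_assoc] at h
    exact inf_eq_left.mp h.symm
  have hJgen (i : Fin r) : IsGenByDegreeLE (J i (m * n i)) (c * m * n i) := by
    obtain ⟨-, S, hS, h⟩ := hJb i (m * n i)
    refine ⟨S, fun a ha => ?_, h⟩
    rw [Finsupp.degree_eq_sum, mul_assoc]
    exact (hS a ha).trans (Nat.mul_le_mul_right _ hc.le)
  have hbase : levelSet (GammaHatSet 𝕜 I J c n0 (fun _ => 0)) m =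
      truncExponents (I (m * n0)) (c * m * n0) := by
    simp [levelSet_gammaHatSet, (hJ _).1, ← Ideal.one_eq_top]
  have hsingle (i : Fin r) : levelSet (GammaHatSet 𝕜 I J c 0 (Pi.single i (n i))) m =
      truncExponents (J i (m * n i)) (c * m * n i) := by
    rw [levelSet_gammaHatSet, mul_zero, hI.1, ← Ideal.one_eq_top, one_mul, zero_add,
      Finset.sum_pi_single' i (n i), if_pos (Finset.mem_univ i),
      Fintype.prod_eq_single i fun j hj => by
        rw [Pi.single_eq_of_ne hj, mul_zero, (hJ j).1, Ideal.one_eq_top], Pi.single_eq_same]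
  rw [hbase, Finset.sum_congr rfl fun i _ => hsingle i, levelSet_gammaHatSet, mul_add,
    Finset.mul_sum, truncExponents_mul hIgen (.prod _ fun i _ => hJgen i),
    truncExponents_prod _ fun i _ => hJgen i]
end
end
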